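/- arXiv:0909.1623 — 2 statements merged into one kernel-verified Lean document; each statement's English description precedes it below -/
import Mathlib

section
/- Analysis channel in polyphase form: let h, x : ℤ → ℂ be finitely supported with sampling period T and define y(n) = (h ∗ x)(2n), which has sampling period 2T. Let x₀, x₁ be the type-1 polyphase components of x and h₀, h₁ the type-2 polyphase components of h (or vice versa). Then the DTLCT Y of y (sampling period 2T) satisfies Y(ω) = exp( −i·d·b·ω²/(8T²) )·( H₀(ω)·X₀(ω) + H₁(ω)·X₁(ω) ) for all ω ∈ ℝ, where X₀, X₁, H₀, H₁ are DTLCTs with sampling period 2T. -/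
open Real Complex

/-- Discrete-time linear canonical transform (constant prefactor omitted). -/
noncomputable def dtlct (a b d T : ℝ) (x : ℤ → ℂ) (ω : ℝ) : ℂ :=
  ∑ᶠ n : ℤ, x n * Complex.exp ((Complex.I / 2) *
    (((a / b) * (n : ℝ) ^ 2 * T ^ 2 - 2 * (n : ℝ) * ω + (d * b / T ^ 2) * ω ^ 2 : ℝ) : ℂ))

/-- LCT convolution at sampling period `T`. -/
noncomputable def lctConv (a b T : ℝ) (h x : ℤ → ℂ) (n : ℤ) : ℂ :=
  ∑ᶠ k : ℤ, h k * x (n - k) *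
    Complex.exp (-Complex.I * (((a * T ^ 2 / b) * (k : ℝ) * ((n : ℝ) - (k : ℝ)) : ℝ) : ℂ))

/-- Zeroth polyphase component (same for type 1 and type 2). -/
noncomputable def poly0 (x : ℤ → ℂ) (n : ℤ) : ℂ := x (2 * n)

/-- First type-1 polyphase component. -/
noncomputable def poly1T1 (a b T : ℝ) (x : ℤ → ℂ) (n : ℤ) : ℂ :=
  x (2 * n - 1) * Complex.exp (Complex.I *
    (((a * T ^ 2 / (2 * b)) * (1 - 4 * (n : ℝ)) : ℝ) : ℂ))

/-- First type-2 polyphase component. -/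
noncomputable def poly1T2 (a b T : ℝ) (x : ℤ → ℂ) (n : ℤ) : ℂ :=
  x (2 * n + 1) * Complex.exp (Complex.I *
    (((a * T ^ 2 / (2 * b)) * (4 * (n : ℝ) + 1) : ℝ) : ℂ))

open Function

theorem finsum_int_even_add_odd {M : Type*} [AddCommMonoid M] {f : ℤ → M}
    (hf : (support f).Finite) {e : ℤ} (he : Odd e) :
    ∑ᶠ k, f k = ∑ᶠ m, f (2 * m) + ∑ᶠ m, f (2 * m + e) := by
  obtain ⟨r, rfl⟩ := he
  have h0 : Injective fun m : ℤ => 2 * m := fun m n h => by grind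
  have h1 : Injective fun m : ℤ => 2 * m + (2 * r + 1) := fun m n h => by grind
  have hU : (Set.range fun m : ℤ => 2 * m) ∪ (Set.range fun m : ℤ => 2 * m + (2 * r + 1)) =
      Set.univ := by
    refine Set.eq_univ_of_forall fun k => ?_
    rcases Int.even_or_odd' k with ⟨m, h | h⟩
    · exact Or.inl ⟨m, h.symm⟩
    · exact Or.inr ⟨m - r, by grind⟩
  rw [← finsum_mem_range h0, ← finsum_mem_range h1, ← finsum_mem_union' ?_
    (hf.subset Set.inter_subset_right) (hf.subset Set.inter_subset_right), hU, finsum_mem_univ]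
  rw [Set.disjoint_left]
  rintro _ ⟨m, rfl⟩ ⟨n, h⟩
  grind

section CauchyProduct

variable {G R : Type*} [AddCommGroup G] [Semiring R] {u v : G → R}

theorem finite_support_mul_sub (hu : (support u).Finite) (hv : (support v).Finite) :
    (support fun q : G × G => u q.2 * v (q.1 - q.2)).Finite := by
  refine ((hu.prod hv).image fun q => (q.1 + q.2, q.1)).subset fun q hq => ?_
  exact ⟨(q.2, q.1 - q.2), ⟨left_ne_zero_of_mul hq, right_ne_zero_of_mul hq⟩, by simp⟩

theorem finite_support_finsum_mul_sub (hu : (support u).Finite) (hv : (support v).Finite) :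
    (support fun n => ∑ᶠ m, u m * v (n - m)).Finite := by
  refine ((finite_support_mul_sub hu hv).image Prod.fst).subset fun n hn => ?_
  obtain ⟨m, hm⟩ : ∃ m, u m * v (n - m) ≠ 0 := by
    by_contra! H
    exact hn (by simp [H])
  exact ⟨(n, m), hm, rfl⟩

theorem finsum_mul_finsum_eq_finsum_sub (hu : (support u).Finite) (hv : (support v).Finite) :
    (∑ᶠ m, u m) * ∑ᶠ p, v p = ∑ᶠ n, ∑ᶠ m, u m * v (n - m) := by
  let e : G × G ≃ G × G :=
    { toFun := fun q => (q.2, q.1 - q.2)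
      invFun := fun q => (q.1 + q.2, q.1)
      left_inv := fun q => by simp
      right_inv := fun q => by simp }
  rw [finsum_mul' _ _ hu]
  simp_rw [mul_finsum' v _ hv]
  rw [← finsum_curry (fun q : G × G => u q.1 * v q.2), ← finsum_comp_equiv e]
  · exact finsum_curry (fun q : G × G => u q.2 * v (q.1 - q.2)) (finite_support_mul_sub hu hv)
  · exact (hu.prod hv).subset fun q hq => ⟨left_ne_zero_of_mul hq, right_ne_zero_of_mul hq⟩

end CauchyProduct

/-- The analysis channel with the odd components of `h` and `x` shifted by `e` and `-e`. -/
theorem dtlct_lctConv_two_mul {a b d T : ℝ} (hb : b ≠ 0) (hT : T ≠ 0) {h x : ℤ → ℂ}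
    (hh : (support h).Finite) (hx : (support x).Finite) {e : ℤ} (he : e ^ 2 = 1) (ω : ℝ) :
    dtlct a b d (2 * T) (fun n => lctConv a b T h x (2 * n)) ω =
      Complex.exp (-Complex.I * ((d * b * ω ^ 2 / (8 * T ^ 2) : ℝ) : ℂ)) *
        (dtlct a b d (2 * T) (poly0 h) ω * dtlct a b d (2 * T) (poly0 x) ω +
          dtlct a b d (2 * T) (fun n => h (2 * n + e) * Complex.exp (Complex.I *
              (((a * T ^ 2 / (2 * b)) * (1 + 4 * e * (n : ℝ)) : ℝ) : ℂ))) ω *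
            dtlct a b d (2 * T) (fun n => x (2 * n - e) * Complex.exp (Complex.I *
              (((a * T ^ 2 / (2 * b)) * (1 - 4 * e * (n : ℝ)) : ℝ) : ℂ))) ω) := by
  have hodd : Odd e := by
    rcases (by simpa using he : e = 1 ∨ e = -1) with rfl | rfl <;> decide
  have fin_of {z : ℤ → ℂ} (hz : (support z).Finite) (s : ℤ) (g g' : ℤ → ℂ) :
      (support fun n => z (2 * n + s) * g n * g' n).Finite := by
    refine (hz.preimage (f := fun n : ℤ => 2 * n + s) fun m _ n _ h => by grind).subset
      fun n hn => ?_
    exact left_ne_zero_of_mul (left_ne_zero_of_mul hn)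
  have fin0 {z : ℤ → ℂ} (hz : (support z).Finite) (g : ℤ → ℂ) :
      (support fun n => poly0 z n * g n).Finite := by
    simpa [poly0] using fin_of hz 0 (fun _ => 1) g
  have finx (g g' : ℤ → ℂ) : (support fun n => x (2 * n - e) * g n * g' n).Finite := by
    simpa only [sub_eq_add_neg] using fin_of hx (-e) g g'
  have hT' : (T : ℂ) ≠ 0 := mod_cast hT
  have hb' : (b : ℂ) ≠ 0 := mod_cast hb
  have he' : (e : ℂ) ^ 2 = 1 := mod_cast he
  obtain ⟨E, hE⟩ : ∃ E : ℤ → ℂ, E = fun n : ℤ => Complex.exp ((Complex.I / 2) *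
      (((a / b) * (n : ℝ) ^ 2 * (2 * T) ^ 2 - 2 * (n : ℝ) * ω +
        (d * b / (2 * T) ^ 2) * ω ^ 2 : ℝ) : ℂ)) := ⟨_, rfl⟩
  obtain ⟨P, hP⟩ : ∃ P : ℤ → ℂ, P = fun n : ℤ => Complex.exp (Complex.I *
      (((a * T ^ 2 / (2 * b)) * (1 + 4 * e * (n : ℝ)) : ℝ) : ℂ)) := ⟨_, rfl⟩
  obtain ⟨Q, hQ⟩ : ∃ Q : ℤ → ℂ, Q = fun n : ℤ => Complex.exp (Complex.I *
      (((a * T ^ 2 / (2 * b)) * (1 - 4 * e * (n : ℝ)) : ℝ) : ℂ)) := ⟨_, rfl⟩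
  have hD (z : ℤ → ℂ) : dtlct a b d (2 * T) z ω = ∑ᶠ n, z n * E n := by rw [hE, dtlct]
  have hPn (n : ℤ) := (congrFun hP n).symm
  have hQn (n : ℤ) := (congrFun hQ n).symm
  simp only [hD, hPn, hQn]
  rw [finsum_mul_finsum_eq_finsum_sub (fin0 hh E) (fin0 hx E),
    finsum_mul_finsum_eq_finsum_sub (fin_of hh e P E) (finx Q E),
    ← finsum_add_distrib (finite_support_finsum_mul_sub (fin0 hh E) (fin0 hx E))
      (finite_support_finsum_mul_sub (fin_of hh e P E) (finx Q E)), mul_finsum]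
  subst hE hP hQ
  refine finsum_congr fun n => ?_
  rw [lctConv, finsum_int_even_add_odd _ hodd, mul_add, add_mul, finsum_mul, finsum_mul,
    mul_finsum, mul_finsum]
  · congr 1 <;> refine finsum_congr fun m => ?_
    · rw [poly0, poly0, show 2 * n - 2 * m = 2 * (n - m) by ring]
      have key : ∀ p q A B C D E : ℂ, A + B = C + (D + E) →
          p * q * Complex.exp A * Complex.exp B =
            Complex.exp C * (p * Complex.exp D * (q * Complex.exp E)) := by
        intro p q A B C D E H
        have := congrArg Complex.exp H
        simp only [Complex.exp_add] at this
        linear_combination p * q * this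
      apply key
      push_cast
      field_simp
      ring
    · rw [show 2 * n - (2 * m + e) = 2 * (n - m) - e by ring]
      have key : ∀ p q A B C D E F G : ℂ, A + B = C + (D + E + (F + G)) →
          p * q * Complex.exp A * Complex.exp B =
            Complex.exp C * (p * Complex.exp D * Complex.exp E *
              (q * Complex.exp F * Complex.exp G)) := by
        intro p q A B C D E F G H
        have := congrArg Complex.exp H
        simp only [Complex.exp_add] at this
        linear_combination p * q * this
      apply key
      push_cast
      field_simp
      ring_nf
      simp only [he']
      ring
  · exact hh.subset fun k hk => left_ne_zero_of_mul (left_ne_zero_of_mul hk)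

/-- Analysis channel in polyphase form: if `y(n) = (h ∗ x)(2n)` then
`Y(ω) = exp(−i·d·b·ω²/(8T²))·(H₀(ω)X₀(ω) + H₁(ω)X₁(ω))`, where the polyphase
components of `h` and `x` are of different types (type-2/type-1 or vice versa). -/
theorem dtlct_analysis_channel_polyphase
    (a b c d T : ℝ) (hb : 0 < b) (habcd : a * d - b * c = 1) (hT : 0 < T)
    (h x : ℤ → ℂ) (hh : (Function.support h).Finite) (hx : (Function.support x).Finite)
    (y : ℤ → ℂ) (hy : ∀ n : ℤ, y n = lctConv a b T h x (2 * n)) :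
    ∀ ω : ℝ,
      (dtlct a b d (2 * T) y ω =
          Complex.exp (-Complex.I * ((d * b * ω ^ 2 / (8 * T ^ 2) : ℝ) : ℂ)) *
            (dtlct a b d (2 * T) (poly0 h) ω * dtlct a b d (2 * T) (poly0 x) ω +
              dtlct a b d (2 * T) (poly1T2 a b T h) ω *
                dtlct a b d (2 * T) (poly1T1 a b T x) ω)) ∧
      (dtlct a b d (2 * T) y ω =
          Complex.exp (-Complex.I * ((d * b * ω ^ 2 / (8 * T ^ 2) : ℝ) : ℂ)) *
            (dtlct a b d (2 * T) (poly0 h) ω * dtlct a b d (2 * T) (poly0 x) ω +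
              dtlct a b d (2 * T) (poly1T1 a b T h) ω *
                dtlct a b d (2 * T) (poly1T2 a b T x) ω)) := by
  intro ω
  obtain rfl : y = fun n => lctConv a b T h x (2 * n) := funext hy
  constructor
  · rw [dtlct_lctConv_two_mul hb.ne' hT.ne' hh hx (e := 1) (by norm_num)]
    congr! 4 <;> funext n <;> simp [poly1T1, poly1T2, add_comm]
  · rw [dtlct_lctConv_two_mul hb.ne' hT.ne' hh hx (e := -1) (by norm_num)]
    congr! 4 <;> funext n <;> simp [poly1T1, poly1T2, add_comm, sub_eq_add_neg]
end

section
/- Single-channel modulation relation at the shifted frequency: let h, g, x : ℤ → ℂ be finitely supported with sampling period T, and let x̂ = g ∗ up2( down2( h ∗ x ) ), where down2(u)(n) = u(2n) and up2(y)(2n) = y(n), up2(y)(m) = 0 for odd m. Then for all ω ∈ ℝ, X̂(ω + π) = (1/2)·Σ_{m=0}^{1} exp( −i·d·b·(ω + mπ)²/T² )·G(ω + π)·H(ω + mπ)·X(ω + mπ), where X̂, G, H, X are DTLCTs with sampling period T. -/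
open Real Complex

/-- Downsampling by 2. -/
def down2 (u : ℤ → ℂ) (n : ℤ) : ℂ := u (2 * n)

/-- Upsampling by 2. -/
noncomputable def up2 (y : ℤ → ℂ) (m : ℤ) : ℂ := if 2 ∣ m then y (m / 2) else 0

/-- The kernel of the discrete-time linear canonical transform. -/
noncomputable def dtlctKernel (a b d T : ℝ) (n : ℤ) (ω : ℝ) : ℂ :=
  Complex.exp ((Complex.I / 2) *
    (((a / b) * (n : ℝ) ^ 2 * T ^ 2 - 2 * (n : ℝ) * ω + (d * b / T ^ 2) * ω ^ 2 : ℝ) : ℂ))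

theorem dtlct_eq_finsum_kernel (a b d T : ℝ) (x : ℤ → ℂ) (ω : ℝ) :
    dtlct a b d T x ω = ∑ᶠ n : ℤ, x n * dtlctKernel a b d T n ω := rfl

theorem dtlctKernel_add (a b d T : ℝ) (k j : ℤ) (ω : ℝ) :
    Complex.exp (-Complex.I * (((a * T ^ 2 / b) * (k : ℝ) * (j : ℝ) : ℝ) : ℂ)) *
        dtlctKernel a b d T (k + j) ω =
      Complex.exp (-(Complex.I / 2) * ((d * b / T ^ 2 * ω ^ 2 : ℝ) : ℂ)) *
        dtlctKernel a b d T k ω * dtlctKernel a b d T j ω := by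
  simp only [dtlctKernel, ← Complex.exp_add]
  congr 1
  push_cast
  ring

theorem dtlctKernel_add_pi (a b d T : ℝ) (n : ℤ) (ω : ℝ) :
    dtlctKernel a b d T n (ω + π) =
      Complex.exp ((Complex.I / 2) * ((d * b / T ^ 2 * ((ω + π) ^ 2 - ω ^ 2) : ℝ) : ℂ)) *
        ((-1) ^ n * dtlctKernel a b d T n ω) := by
  have h : ((-1 : ℂ)) ^ n = Complex.exp (-(n * (π * Complex.I))) := by
    rw [Complex.exp_neg, Complex.exp_int_mul, Complex.exp_pi_mul_I, ← inv_zpow]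
    norm_num
  simp only [dtlctKernel, h, ← Complex.exp_add]
  congr 1
  push_cast
  ring

theorem finite_support_mul_right {ι R : Type*} [MulZeroClass R] {f : ι → R}
    (hf : (Function.support f).Finite) (g : ι → R) :
    (Function.support fun i => f i * g i).Finite :=
  hf.subset (Function.support_mul_subset_left f g)

theorem finite_support_lctConv (a b T : ℝ) {h x : ℤ → ℂ} (hh : (Function.support h).Finite)
    (hx : (Function.support x).Finite) : (Function.support (lctConv a b T h x)).Finite := by
  refine (hh.image2 (· + ·) hx).subset fun n hn => ?_
  obtain ⟨k, hk⟩ := not_forall.mp (mt finsum_eq_zero_of_forall_eq_zero hn)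
  have hk' := left_ne_zero_of_mul hk
  exact ⟨k, left_ne_zero_of_mul hk', n - k, right_ne_zero_of_mul hk', add_sub_cancel k n⟩

/-- The convolution theorem for the discrete-time linear canonical transform. -/
theorem dtlct_lctConv (a b d T : ℝ) {h x : ℤ → ℂ} (hh : (Function.support h).Finite)
    (hx : (Function.support x).Finite) (ω : ℝ) :
    dtlct a b d T (lctConv a b T h x) ω =
      Complex.exp (-(Complex.I / 2) * ((d * b / T ^ 2 * ω ^ 2 : ℝ) : ℂ)) *
        dtlct a b d T h ω * dtlct a b d T x ω := by
  set E := Complex.exp (-(Complex.I / 2) * ((d * b / T ^ 2 * ω ^ 2 : ℝ) : ℂ)) with hE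
  have hxK := finite_support_mul_right hx fun n => dtlctKernel a b d T n ω
  have hterm (n k : ℤ) : h k * x (n - k) *
      Complex.exp (-Complex.I * (((a * T ^ 2 / b) * (k : ℝ) * ((n : ℝ) - (k : ℝ)) : ℝ) : ℂ)) *
        dtlctKernel a b d T n ω =
      E * (h k * dtlctKernel a b d T k ω) * (x (n - k) * dtlctKernel a b d T (n - k) ω) := by
    have := dtlctKernel_add a b d T k (n - k) ω
    rw [add_sub_cancel, Int.cast_sub, ← hE] at this
    linear_combination h k * x (n - k) * this
  have hconv (n : ℤ) : lctConv a b T h x n * dtlctKernel a b d T n ω =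
      ∑ k ∈ hh.toFinset,
        E * (h k * dtlctKernel a b d T k ω) * (x (n - k) * dtlctKernel a b d T (n - k) ω) := by
    rw [lctConv, finsum_eq_sum_of_support_subset (s := hh.toFinset), Finset.sum_mul]
    · exact Finset.sum_congr rfl fun k _ => hterm n k
    · intro k hk
      simpa using left_ne_zero_of_mul (left_ne_zero_of_mul hk)
  have hshift (k : ℤ) : (Function.support fun n : ℤ =>
      x (n - k) * dtlctKernel a b d T (n - k) ω).Finite :=
    hxK.preimage (sub_left_injective (b := k)).injOn
  simp only [dtlct_eq_finsum_kernel, hconv]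
  rw [finsum_sum_comm]
  · have hsum (k : ℤ) : ∑ᶠ n : ℤ, E * (h k * dtlctKernel a b d T k ω) *
          (x (n - k) * dtlctKernel a b d T (n - k) ω) =
        E * (h k * dtlctKernel a b d T k ω) * ∑ᶠ n : ℤ, x n * dtlctKernel a b d T n ω := by
      rw [← mul_finsum]
      congr 1
      exact finsum_comp_equiv (Equiv.subRight k) (f := fun n => x n * dtlctKernel a b d T n ω)
    simp only [hsum]
    rw [← Finset.sum_mul, ← Finset.mul_sum, finsum_eq_sum_of_support_subset (s := hh.toFinset)
      (fun k => h k * dtlctKernel a b d T k ω)]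
    intro k hk
    simpa using left_ne_zero_of_mul hk
  · intro k _
    exact (hshift k).subset (Function.support_mul_subset_right _ _)

theorem up2_down2_apply (u : ℤ → ℂ) (n : ℤ) :
    up2 (down2 u) n = (1 / 2 : ℂ) * (u n + (-1) ^ n * u n) := by
  unfold up2 down2
  split_ifs with hn
  · rw [Int.mul_ediv_cancel' hn, (even_iff_two_dvd.mpr hn).neg_one_zpow]
    ring
  · rw [(Int.not_even_iff_odd.mp (mt even_iff_two_dvd.mp hn)).neg_one_zpow]
    ring

theorem finite_support_up2_down2 {u : ℤ → ℂ} (hu : (Function.support u).Finite) :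
    (Function.support (up2 (down2 u))).Finite := by
  refine hu.subset fun n hn hun => hn ?_
  simp [up2_down2_apply, hun]

/-- Downsampling followed by upsampling averages the transform with its alias. -/
theorem dtlct_up2_down2_add_pi (a b d T : ℝ) {u : ℤ → ℂ} (hu : (Function.support u).Finite)
    (ω : ℝ) :
    dtlct a b d T (up2 (down2 u)) (ω + π) =
      (1 / 2 : ℂ) * (dtlct a b d T u (ω + π) +
        Complex.exp ((Complex.I / 2) * ((d * b / T ^ 2 * ((ω + π) ^ 2 - ω ^ 2) : ℝ) : ℂ)) *
          dtlct a b d T u ω) := by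
  have h₀ := finite_support_mul_right hu fun n => dtlctKernel a b d T n ω
  have h₁ := finite_support_mul_right hu fun n => dtlctKernel a b d T n (ω + π)
  set E := Complex.exp ((Complex.I / 2) * ((d * b / T ^ 2 * ((ω + π) ^ 2 - ω ^ 2) : ℝ) : ℂ))
    with hE
  have hterm (n : ℤ) : up2 (down2 u) n * dtlctKernel a b d T n (ω + π) =
      (1 / 2 : ℂ) * (u n * dtlctKernel a b d T n (ω + π) +
        E * (u n * dtlctKernel a b d T n ω)) := by
    have hsq : ((-1 : ℂ) ^ n) * (-1) ^ n = 1 := by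
      rw [← mul_zpow]
      norm_num
    rw [up2_down2_apply, dtlctKernel_add_pi, ← hE]
    linear_combination (1 / 2 : ℂ) * E * u n * dtlctKernel a b d T n ω * hsq
  have h₂ : (Function.support fun n => E * (u n * dtlctKernel a b d T n ω)).Finite :=
    h₀.subset (Function.support_mul_subset_right _ _)
  simp only [dtlct_eq_finsum_kernel, hterm]
  rw [← mul_finsum,
    finsum_add_distrib h₁ h₂, ← mul_finsum]

/-- Single-channel modulation relation at the shifted frequency:
`X̂(ω+π) = (1/2)·Σ_{m=0}^{1} exp(−i·d·b·(ω+mπ)²/T²)·G(ω+π)·H(ω+mπ)·X(ω+mπ)`. -/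
theorem dtlct_channel_modulation_shifted
    (a b c d T : ℝ) (hb : 0 < b) (habcd : a * d - b * c = 1) (hT : 0 < T)
    (h g x : ℤ → ℂ) (hh : (Function.support h).Finite) (hg : (Function.support g).Finite)
    (hx : (Function.support x).Finite)
    (xhat : ℤ → ℂ)
    (hxhat : ∀ n : ℤ, xhat n = lctConv a b T g (up2 (down2 (lctConv a b T h x))) n) :
    ∀ ω : ℝ,
      dtlct a b d T xhat (ω + π) =
        (1 / 2 : ℂ) * ∑ m ∈ Finset.range 2,
          Complex.exp (-Complex.I * ((d * b * (ω + (m : ℝ) * π) ^ 2 / T ^ 2 : ℝ) : ℂ)) *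
            dtlct a b d T g (ω + π) * dtlct a b d T h (ω + (m : ℝ) * π) *
              dtlct a b d T x (ω + (m : ℝ) * π) := by
  intro ω
  have hu := finite_support_lctConv a b T hh hx
  have hsq : Complex.exp (-Complex.I * ((d * b * (ω + π) ^ 2 / T ^ 2 : ℝ) : ℂ)) =
      Complex.exp (-(Complex.I / 2) * ((d * b / T ^ 2 * (ω + π) ^ 2 : ℝ) : ℂ)) *
        Complex.exp (-(Complex.I / 2) * ((d * b / T ^ 2 * (ω + π) ^ 2 : ℝ) : ℂ)) := by
    rw [← Complex.exp_add]
    congr 1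
    push_cast
    ring
  have halias : Complex.exp (-Complex.I * ((d * b * ω ^ 2 / T ^ 2 : ℝ) : ℂ)) =
      Complex.exp (-(Complex.I / 2) * ((d * b / T ^ 2 * (ω + π) ^ 2 : ℝ) : ℂ)) *
        Complex.exp ((Complex.I / 2) * ((d * b / T ^ 2 * ((ω + π) ^ 2 - ω ^ 2) : ℝ) : ℂ)) *
          Complex.exp (-(Complex.I / 2) * ((d * b / T ^ 2 * ω ^ 2 : ℝ) : ℂ)) := by
    rw [← Complex.exp_add, ← Complex.exp_add]
    congr 1
    push_cast
    ring
  rw [funext hxhat, dtlct_lctConv a b d T hg (finite_support_up2_down2 hu),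
    dtlct_up2_down2_add_pi a b d T hu, dtlct_lctConv a b d T hh hx, dtlct_lctConv a b d T hh hx]
  simp only [Finset.sum_range_succ, Finset.sum_range_zero, Nat.cast_zero, Nat.cast_one, zero_mul,
    one_mul, add_zero, zero_add]
  rw [hsq, halias]
  ring
end
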